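/- arXiv:1003.0999 — 3 statements merged into one kernel-verified Lean document; each statement's English description precedes it below -/
import Mathlib

section
/- Let E and F be Banach spaces and let t ↦ K(t) be a path of continuous linear operators from E to F, defined on a real interval, which is continuous for the strong operator topology (i.e., t ↦ K(t)v is continuous for every v ∈ E). Assume t ↦ K(t)v is differentiable for every v in a subspace D of E, and write K'(t) : D → F for the linear operator K'(t)v := (d/dt)K(t)v. Let t ↦ γ(t) be a differentiable path in D. Then t ↦ K(t)γ(t) is differentiable with derivative (d/dt)(K(t)γ(t)) = K'(t)γ(t) + K(t)γ'(t). -/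
open Filter Topology

/-- Along a countably generated filter, strong convergence of bounded operators on a Banach space
is jointly continuous with norm convergence of vectors, by the uniform boundedness principle. -/
theorem tendsto_clm_apply_of_tendsto_strong
    {ι E F : Type*} [NormedAddCommGroup E] [NormedSpace ℝ E] [CompleteSpace E]
    [NormedAddCommGroup F] [NormedSpace ℝ F]
    {l : Filter ι} [l.IsCountablyGenerated] {K : ι → E →L[ℝ] F} {L : E →L[ℝ] F}
    (hK : ∀ v, Tendsto (fun i => K i v) l (𝓝 (L v)))
    {x : ι → E} {a : E} (hx : Tendsto x l (𝓝 a)) :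
    Tendsto (fun i => K i (x i)) l (𝓝 (L a)) := by
  refine tendsto_of_seq_tendsto fun u hu => ?_
  obtain ⟨C, hC⟩ : ∃ C, ∀ n, ‖K (u n)‖ ≤ C := by
    refine banach_steinhaus fun v => ?_
    obtain ⟨C, hC⟩ := ((hK v).comp hu).norm.bddAbove_range
    exact ⟨C, fun n => hC ⟨n, rfl⟩⟩
  have hsub : Tendsto (fun n => x (u n) - a) atTop (𝓝 0) :=
    tendsto_sub_nhds_zero_iff.2 (hx.comp hu)
  have hzero : Tendsto (fun n => K (u n) (x (u n) - a)) atTop (𝓝 0) := by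
    refine squeeze_zero_norm (fun n => (K (u n)).le_of_opNorm_le (hC n) _) ?_
    simpa using hsub.norm.const_mul C
  simpa [Function.comp_def] using hzero.add ((hK a).comp hu)

/-- Lemma on the product rule. Let `E`, `F` be Banach spaces and
`t ↦ K t` a path of continuous linear operators from `E` to `F`, defined on a real
interval `I`, continuous for the strong operator topology. Assume `t ↦ K t v` is
differentiable on `I` for every `v` in a subspace `D` of `E`, with derivative `K' t v`,
and let `γ` be a differentiable path in `D`. Then `t ↦ K t (γ t)` is differentiable with
derivative `K' t (γ t) + K t (γ' t)`. -/
theorem product_rule_strong_operator_topology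
    {E F : Type*} [NormedAddCommGroup E] [NormedSpace ℝ E] [CompleteSpace E]
    [NormedAddCommGroup F] [NormedSpace ℝ F] [CompleteSpace F]
    -- a real interval
    (I : Set ℝ) (hI : I.OrdConnected)
    -- a strongly continuous path of bounded operators
    (K : ℝ → E →L[ℝ] F)
    (hKcont : ∀ v : E, ContinuousOn (fun t : ℝ => K t v) I)
    -- a subspace `D` on which `t ↦ K t v` is differentiable, with derivative `K' t v`
    (D : Submodule ℝ E)
    (K' : ℝ → D →ₗ[ℝ] F)
    (hK' : ∀ (v : D), ∀ t ∈ I, HasDerivWithinAt (fun s : ℝ => K s (v : E)) (K' t v) I t)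
    -- a differentiable path `γ` in `D`
    (γ : ℝ → E) (γ' : ℝ → E)
    (hγmem : ∀ t ∈ I, γ t ∈ D)
    (hγ : ∀ t ∈ I, HasDerivWithinAt γ (γ' t) I t) :
    ∀ t (ht : t ∈ I),
      HasDerivWithinAt (fun s : ℝ => K s (γ s))
        (K' t ⟨γ t, hγmem t ht⟩ + K t (γ' t)) I t := by
  intro t ht
  have hKγ := hasDerivWithinAt_iff_tendsto_slope.1 (hK' ⟨γ t, hγmem t ht⟩ t ht)
  have hslope := hasDerivWithinAt_iff_tendsto_slope.1 (hγ t ht)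
  rw [hasDerivWithinAt_iff_tendsto_slope]
  have hK : ∀ v, Tendsto (fun s => K s v) (𝓝[I \ {t}] t) (𝓝 (K t v)) := fun v =>
    (hKcont v t ht).mono_left (nhdsWithin_mono _ Set.sdiff_subset)
  refine (hKγ.add (tendsto_clm_apply_of_tendsto_strong hK hslope)).congr fun s => ?_
  simp only [slope_def_module, map_smul, map_sub, ← smul_add]
  congr 1
  abel
end

section
/- Let A and B be unbounded operators defined on a common dense domain D of a Hilbert space H. Assume that A is essentially skew-adjoint, that A D ⊆ D and e^{tA} D ⊆ D for all t ∈ ℝ (where e^{tA} denotes the strongly continuous one-parameter unitary group generated by the closure of A), and that B is closable. Let v ∈ D be such that the map t ↦ B A e^{tA}v is continuous. Then the map t ↦ B e^{tA}v is differentiable with derivative (d/dt) B e^{tA}v = B A e^{tA}v. -/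
open scoped ComplexInnerProductSpace
open Asymptotics

noncomputable section

/-- The unbounded operator on `H` associated to a linear map defined on a submodule `D`. -/
def toPMap {H : Type*} [NormedAddCommGroup H] [InnerProductSpace ℂ H]
    (D : Submodule ℂ H) (A : D →ₗ[ℂ] H) : H →ₗ.[ℂ] H := ⟨D, A⟩

/-- An unbounded operator is essentially skew-adjoint if it is closable and its closure `Ā`
is skew-adjoint, i.e. `Ā* = -Ā`. -/
def IsEssentiallySkewAdjoint {H : Type*} [NormedAddCommGroup H] [InnerProductSpace ℂ H]
    [CompleteSpace H] (D : Submodule ℂ H) (A : D →ₗ[ℂ] H) : Prop :=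
  (toPMap D A).IsClosable ∧ ((toPMap D A).closure).adjoint = -((toPMap D A).closure)

/-- `U` is a strongly continuous one-parameter unitary group whose infinitesimal generator
extends `A`; for `A` essentially skew-adjoint this says exactly that `U t = e^{tA}` is the
unitary group generated by the closure of `A` (via Stone's theorem). -/
structure IsGeneratedUnitaryGroup {H : Type*} [NormedAddCommGroup H] [InnerProductSpace ℂ H]
    [CompleteSpace H] (D : Submodule ℂ H) (A : D →ₗ[ℂ] H)
    (U : ℝ → H →L[ℂ] H) : Prop where
  mem_unitary : ∀ t : ℝ, U t ∈ unitary (H →L[ℂ] H)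
  map_zero : U 0 = 1
  map_add : ∀ s t : ℝ, U (s + t) = U s * U t
  strong_continuous : ∀ w : H, Continuous fun t : ℝ => U t w
  hasDerivAt : ∀ v : D, HasDerivAt (fun t : ℝ => U t (v : H)) (A v) 0

/-- The operator `D → H` obtained from an operator `A : D → D` by corestriction. -/
def opH {H : Type*} [NormedAddCommGroup H] [InnerProductSpace ℂ H]
    (D : Submodule ℂ H) (A : D →ₗ[ℂ] D) : D →ₗ[ℂ] H := D.subtype.comp A

/-- A vector `v ∈ D` is an analytic vector for an operator `A : D → D` if
`Σ ‖Aⁿ v‖ tⁿ/n!` has positive radius of convergence. -/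
def IsAnalyticVector {H : Type*} [NormedAddCommGroup H] [InnerProductSpace ℂ H]
    (D : Submodule ℂ H) (A : D →ₗ[ℂ] D) (v : D) : Prop :=
  ∃ t : ℝ, 0 < t ∧ Summable fun k : ℕ => ‖(((A ^ k) v : D) : H)‖ * t ^ k / (Nat.factorial k)

/-- A strongly continuous representation of a Banach--Lie algebra `g` by skew-symmetric
operators on a domain `D` of a complex Hilbert space. -/
structure IsSkewSymRep {H : Type*} [NormedAddCommGroup H] [InnerProductSpace ℂ H]
    {g : Type*} [NormedAddCommGroup g] [NormedSpace ℝ g] [LieRing g] [LieAlgebra ℝ g]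
    (D : Submodule ℂ H) (α : g →ₗ[ℝ] (D →ₗ[ℂ] D)) : Prop where
  skew : ∀ (x : g) (v w : D), ⟪((α x v : D) : H), (w : H)⟫ = -⟪(v : H), ((α x w : D) : H)⟫
  bracket : ∀ x y : g, α ⁅x, y⁆ = α x ∘ₗ α y - α y ∘ₗ α x
  strong_cont : ∀ v : D, Continuous fun x : g => ((α x v : D) : H)

end

open MeasureTheory

section

variable {H : Type*} [NormedAddCommGroup H] [InnerProductSpace ℂ H]

/-- A closable operator commutes with the integral: if `f` and `B ∘ f` are continuous and
`∫ f` lies in the domain, then `B (∫ f) = ∫ B ∘ f`. -/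
lemma apply_eq_intervalIntegral_of_isClosable [CompleteSpace H] {D : Submodule ℂ H}
    {B : D →ₗ[ℂ] H} (hB : (toPMap D B).IsClosable) {f : ℝ → D}
    (hf : Continuous fun t => (f t : H)) (hBf : Continuous fun t => B (f t)) {a b : ℝ} {x : D}
    (hx : (x : H) = ∫ t in a..b, (f t : H)) :
    B x = ∫ t in a..b, B (f t) := by
  obtain ⟨C, hC⟩ := hB
  set K := (toPMap D B).graph.topologicalClosure
  have hmem : ∀ y : D, ((y : H), B y) ∈ K := fun y =>
    Submodule.le_topologicalClosure _ ((toPMap D B).mem_graph y)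
  have : CompleteSpace K :=
    ((toPMap D B).graph.isClosed_topologicalClosure).completeSpace_coe
  let F : ℝ → K := fun t => ⟨((f t : H), B (f t)), hmem (f t)⟩
  have hF : IntervalIntegrable F volume a b :=
    ((hf.prodMk hBf).subtype_mk fun t => hmem (f t)).intervalIntegrable a b
  have h₁ : ∫ t in a..b, (f t : H) = (∫ t in a..b, F t : K).1.1 :=
    ((ContinuousLinearMap.fst ℂ H H).comp K.subtypeL).intervalIntegral_comp_comm hF
  have h₂ : ∫ t in a..b, B (f t) = (∫ t in a..b, F t : K).1.2 :=
    ((ContinuousLinearMap.snd ℂ H H).comp K.subtypeL).intervalIntegral_comp_comm hF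
  have hx' : ((x : H), ∫ t in a..b, B (f t)) ∈ K := by
    rw [hx, h₁, h₂]
    exact (∫ t in a..b, F t : K).2
  have hK : K = C.graph := hC
  have hBx := hmem x
  rw [hK] at hx' hBx
  exact C.mem_graph_snd_inj' hBx hx' rfl

variable [CompleteSpace H] {D : Submodule ℂ H} {A : D →ₗ[ℂ] H} {U : ℝ → H →L[ℂ] H}

lemma IsGeneratedUnitaryGroup.hasDerivAt_apply (hU : IsGeneratedUnitaryGroup D A U) (v : D)
    (t : ℝ) : HasDerivAt (fun s => U s (v : H)) (U t (A v)) t := by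
  have h₀ : HasDerivAt (fun s => U s (v : H)) (A v) (t - t) := by
    simpa using hU.hasDerivAt v
  have h := ((U t).restrictScalars ℝ).hasFDerivAt.comp_hasDerivAt t (h₀.comp_sub_const t t)
  refine h.congr_of_eventuallyEq (.of_forall fun s => ?_)
  simpa using DFunLike.congr_fun (hU.map_add t (s - t)) (v : H)

lemma IsGeneratedUnitaryGroup.apply_comm (hU : IsGeneratedUnitaryGroup D A U) (v : D) {t : ℝ}
    (ht : U t (v : H) ∈ D) : A ⟨U t (v : H), ht⟩ = U t (A v) := by
  have h₀ : HasDerivAt (fun s => U s (U t (v : H))) (A ⟨U t (v : H), ht⟩) (t - t) := by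
    simpa using hU.hasDerivAt ⟨U t (v : H), ht⟩
  refine HasDerivAt.unique ?_ (hU.hasDerivAt_apply v t)
  refine (h₀.comp_sub_const t t).congr_of_eventuallyEq (.of_forall fun s => ?_)
  simpa using DFunLike.congr_fun (hU.map_add (s - t) t) (v : H)

end

/-- Lemma on differentiating `t ↦ B e^{tA} v`. Let `A`, `B` be unbounded
operators on a common dense domain `D` of a Hilbert space `H`, with `A` essentially
skew-adjoint, `A D ⊆ D`, `e^{tA} D ⊆ D` for all `t`, and `B` closable. If `v ∈ D` is such
that `t ↦ B A e^{tA} v` is continuous, then `t ↦ B e^{tA} v` is differentiable with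
derivative `B A e^{tA} v`. -/
theorem deriv_B_exp_tA
    {H : Type*} [NormedAddCommGroup H] [InnerProductSpace ℂ H] [CompleteSpace H]
    (D : Submodule ℂ H) (hD : Dense (D : Set H))
    -- `A : D → D` essentially skew-adjoint, with generated unitary group `U t = e^{tA}`
    (A : D →ₗ[ℂ] D)
    (hA : IsEssentiallySkewAdjoint D (opH D A))
    (U : ℝ → H →L[ℂ] H) (hU : IsGeneratedUnitaryGroup D (opH D A) U)
    -- `e^{tA} D ⊆ D`
    (hUD : ∀ (t : ℝ) (v : D), U t (v : H) ∈ D)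
    -- `B` closable
    (B : D →ₗ[ℂ] H) (hB : (toPMap D B).IsClosable)
    -- `v ∈ D` with `t ↦ B A e^{tA} v` continuous
    (v : D)
    (hcont : Continuous fun t : ℝ => B (A ⟨U t (v : H), hUD t v⟩)) :
    ∀ t : ℝ,
      HasDerivAt (fun s : ℝ => B ⟨U s (v : H), hUD s v⟩)
        (B (A ⟨U t (v : H), hUD t v⟩)) t := by
  intro t
  have hAU : ∀ s, ((A ⟨U s (v : H), hUD s v⟩ : D) : H) = U s (A v : H) := fun s =>
    hU.apply_comm v (hUD s v)
  have hAc : Continuous fun s => ((A ⟨U s (v : H), hUD s v⟩ : D) : H) := by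
    simpa only [hAU] using hU.strong_continuous (A v : H)
  have key : ∀ s, B ⟨U s (v : H), hUD s v⟩ =
      B ⟨U t (v : H), hUD t v⟩ + ∫ r in t..s, B (A ⟨U r (v : H), hUD r v⟩) := by
    intro s
    rw [← sub_eq_iff_eq_add', ← map_sub]
    refine apply_eq_intervalIntegral_of_isClosable hB hAc hcont ?_
    refine (intervalIntegral.integral_eq_sub_of_hasDerivAt
      (f := fun s => U s (v : H)) (fun r _ => ?_)
      (hAc.intervalIntegrable t s)).symm
    rw [hAU]
    exact hU.hasDerivAt_apply v r
  rw [funext key]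
  exact (hcont.integral_hasStrictDerivAt t t).hasDerivAt.const_add _
end

section
/- Let A and B be essentially skew-adjoint operators defined on a common dense domain D of a Hilbert space H, and assume e^{sA}D ⊆ D for all s ∈ ℝ. Let v ∈ D be such that s ↦ B e^{sA}v is continuous. Then for all t ∈ ℝ: e^{tB}v − e^{tA}v = ∫₀ᵗ e^{sB}(B − A)e^{(t−s)A}v ds. -/
open scoped ComplexInnerProductSpace
open Asymptotics

namespace IsGeneratedUnitaryGroup

open Filter Topology

variable {H : Type*} [NormedAddCommGroup H] [InnerProductSpace ℂ H] [CompleteSpace H]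
  {D : Submodule ℂ H} {A : D →ₗ[ℂ] H} {U : ℝ → H →L[ℂ] H}

theorem norm_apply (hU : IsGeneratedUnitaryGroup D A U) (s : ℝ) (w : H) : ‖U s w‖ = ‖w‖ :=
  ContinuousLinearMap.norm_map_of_mem_unitary (hU.mem_unitary s) w

/-- A one-parameter unitary group acts jointly continuously, phrased with filters. -/
theorem tendsto_apply (hU : IsGeneratedUnitaryGroup D A U) {l : Filter ℝ} {s : ℝ}
    (hl : l ≤ 𝓝 s) {y : ℝ → H} {w : H} (hy : Tendsto y l (𝓝 w)) :
    Tendsto (fun r => U r (y r)) l (𝓝 (U s w)) := by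
  have h₁ : Tendsto (fun r => U r (y r - w)) l (𝓝 0) := by
    rw [tendsto_zero_iff_norm_tendsto_zero]
    simpa only [hU.norm_apply] using tendsto_iff_norm_sub_tendsto_zero.mp hy
  have h₂ : Tendsto (fun r => U r w) l (𝓝 (U s w)) :=
    ((hU.strong_continuous w).tendsto s).mono_left hl
  simpa using h₁.add h₂

theorem continuous_apply (hU : IsGeneratedUnitaryGroup D A U) {y : ℝ → H} (hy : Continuous y) :
    Continuous fun s => U s (y s) :=
  continuous_iff_continuousAt.mpr fun s => hU.tendsto_apply le_rfl (hy.tendsto s)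

theorem hasDerivAt_orbit (hU : IsGeneratedUnitaryGroup D A U) (v : D) (s : ℝ) :
    HasDerivAt (fun r => U r (v : H)) (U s (A v)) s := by
  have h₀ : HasDerivAt (fun r => U (r - s) (v : H)) (A v) s :=
    HasDerivAt.comp_sub_const s s (by simpa using hU.hasDerivAt v)
  have h := ((U s).restrictScalars ℝ).hasFDerivAt.comp_hasDerivAt s h₀
  refine h.congr_of_eventuallyEq (Eventually.of_forall fun r => ?_)
  simp [← mul_apply_eq_comp, ← hU.map_add]

/-- The generator commutes with the group on invariant vectors. -/
theorem generator_apply_orbit (hU : IsGeneratedUnitaryGroup D A U) (v : D) (s : ℝ)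
    (hs : U s (v : H) ∈ D) : A ⟨U s v, hs⟩ = U s (A v) := by
  have h : HasDerivAt (fun r => U (r + s) (v : H)) (U s (A v)) 0 :=
    HasDerivAt.comp_add_const 0 s (by simpa using hU.hasDerivAt_orbit v s)
  refine (hU.hasDerivAt ⟨U s v, hs⟩).unique ?_
  simpa [hU.map_add] using h

/-- The product rule for a group acting on a differentiable curve. -/
theorem hasDerivAt_apply_s9 (hU : IsGeneratedUnitaryGroup D A U) {x : ℝ → H} {x' : H} {s : ℝ}
    (hx : HasDerivAt x x' s) (hs : x s ∈ D) :
    HasDerivAt (fun r => U r (x r)) (U s (A ⟨x s, hs⟩ + x')) s := by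
  rw [hasDerivAt_iff_tendsto_slope] at hx ⊢
  have h₁ := hU.tendsto_apply inf_le_left hx
  have h₂ := hasDerivAt_iff_tendsto_slope.mp (hU.hasDerivAt_orbit ⟨x s, hs⟩ s)
  rw [_root_.map_add]
  refine (h₂.add h₁).congr fun r => ?_
  simp only [slope_def_module, map_sub, ContinuousLinearMap.map_smul_of_tower]
  module

end IsGeneratedUnitaryGroup

/-- Duhamel-type lemma. Let `A`, `B` be essentially skew-adjoint operators
on a common dense domain `D` with `e^{sA} D ⊆ D` for all `s`, and let `v ∈ D` be such that
`s ↦ B e^{sA} v` is continuous. Then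
`e^{tB} v − e^{tA} v = ∫₀ᵗ e^{sB} (B − A) e^{(t−s)A} v ds`. -/
theorem duhamel_formula
    {H : Type*} [NormedAddCommGroup H] [InnerProductSpace ℂ H] [CompleteSpace H]
    (D : Submodule ℂ H) (hD : Dense (D : Set H))
    -- `A` essentially skew-adjoint with unitary group `UA s = e^{sA}`
    (A : D →ₗ[ℂ] H) (hA : IsEssentiallySkewAdjoint D A)
    (UA : ℝ → H →L[ℂ] H) (hUA : IsGeneratedUnitaryGroup D A UA)
    -- `B` essentially skew-adjoint with unitary group `UB s = e^{sB}`
    (B : D →ₗ[ℂ] H) (hB : IsEssentiallySkewAdjoint D B)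
    (UB : ℝ → H →L[ℂ] H) (hUB : IsGeneratedUnitaryGroup D B UB)
    -- `e^{sA} D ⊆ D` for all `s`
    (hUD : ∀ (s : ℝ) (v : D), UA s (v : H) ∈ D)
    -- `v ∈ D` with `s ↦ B e^{sA} v` continuous
    (v : D)
    (hcont : Continuous fun s : ℝ => B ⟨UA s (v : H), hUD s v⟩) :
    ∀ t : ℝ,
      UB t (v : H) - UA t (v : H)
        = ∫ s in (0:ℝ)..t,
            UB s (B ⟨UA (t - s) (v : H), hUD (t - s) v⟩
              - A ⟨UA (t - s) (v : H), hUD (t - s) v⟩) := by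
  intro t
  have hx (s : ℝ) : HasDerivAt (fun r => UA (t - r) (v : H)) (-UA (t - s) (A v)) s :=
    (hUA.hasDerivAt_orbit v (t - s)).comp_const_sub t s
  have hderiv (s : ℝ) : HasDerivAt (fun r => UB r (UA (t - r) (v : H)))
      (UB s (B ⟨UA (t - s) v, hUD (t - s) v⟩ - A ⟨UA (t - s) v, hUD (t - s) v⟩)) s := by
    rw [hUA.generator_apply_orbit v, sub_eq_add_neg]
    exact hUB.hasDerivAt_apply_s9 (hx s) (hUD (t - s) v)
  have hA_cont : Continuous fun s : ℝ => A ⟨UA s (v : H), hUD s v⟩ := by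
    simpa only [hUA.generator_apply_orbit v] using hUA.strong_continuous (A v)
  have hcont' := hUB.continuous_apply
    ((hcont.sub hA_cont).comp (continuous_const.sub continuous_id : Continuous fun s => t - s))
  rw [intervalIntegral.integral_eq_sub_of_hasDerivAt (fun s _ => hderiv s)
    (hcont'.intervalIntegrable 0 t)]
  simp [hUA.map_zero, hUB.map_zero]
end
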